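/- With β^N as defined, for every positive integer N and every index i with 1 ≤ i < n+m, one has |log(α_i(β^N)/α_i(β^1))| < 2^{i−(n+m)}. -/

import Mathlib

open scoped Real ENNReal
open Filter

/-- The Gauss-map iterates: `alphaIter θ k` is `α_{k+1}(θ)`, i.e. `alphaIter θ 0 = α_1(θ) = θ`
and `α_{i+1}(θ)` is the fractional part of `1/α_i(θ)`. -/
noncomputable def alphaIter (θ : ℝ) : ℕ → ℝ
  | 0 => θ
  | k + 1 => Int.fract (1 / alphaIter θ k)

/-- `HasCF θ a` : `θ` is an irrational number in `(0,1)` whose continued fraction digits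
are given by `a` (0-indexed: `a k` is the digit `a_{k+1}` in 1-indexed notation). -/
def HasCF (θ : ℝ) (a : ℕ → ℕ) : Prop :=
  θ ∈ Set.Ioo (0 : ℝ) 1 ∧ Irrational θ ∧ ∀ k, ⌊1 / alphaIter θ k⌋ = (a k : ℤ)

/-- Yoccoz's Brjuno function `Φ(θ) = Σ_{n≥1} α_1(θ)⋯α_{n-1}(θ)·log(1/α_n(θ))`,
as a real-valued sum. -/
noncomputable def brjunoPhi (θ : ℝ) : ℝ :=
  ∑' k : ℕ, (∏ j ∈ Finset.range k, alphaIter θ j) * Real.log (1 / alphaIter θ k)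

/-- Yoccoz's Brjuno function with values in `ℝ≥0∞` (all terms are nonnegative). -/
noncomputable def brjunoPhiE (θ : ℝ) : ℝ≥0∞ :=
  ∑' k : ℕ, ENNReal.ofReal ((∏ j ∈ Finset.range k, alphaIter θ j) * Real.log (1 / alphaIter θ k))

/-- Digits of the noble number `ω = [a_1,…,a_n,1,1,1,…]`. -/
def nobleDigits (n : ℕ) (a : ℕ → ℕ) : ℕ → ℕ := fun k => if k < n then a k else 1

/-- Digits of `β^N = [a_1,…,a_n,1,…,1,N,1,1,…]`, with `N` in (1-indexed) position `n+m`. -/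
def betaDigits (n m N : ℕ) (a : ℕ → ℕ) : ℕ → ℕ :=
  fun k => if k + 1 = n + m then N else if k < n then a k else 1

/-- Digits of `β^I = [a_1,…,a_n,1,…,1,b_{n+m},b_{n+m+1},…]`: the digits of the noble number
with the whole tail from (1-indexed) position `n+m` on replaced by the tail `b`. -/
def tailDigits (n m : ℕ) (a b : ℕ → ℕ) : ℕ → ℕ :=
  fun k => if k + 1 < n + m then (if k < n then a k else 1) else b k

theorem irrational_alphaIter {θ : ℝ} (hθ : Irrational θ) (k : ℕ) :
    Irrational (alphaIter θ k) := by
  induction k with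
  | zero => exact hθ
  | succ k ih =>
    have h : Irrational (1 / alphaIter θ k) := by simpa using ih
    simpa only [alphaIter, Int.fract] using h.sub_intCast ⌊1 / alphaIter θ k⌋

theorem HasCF.alphaIter_mem_Ioo {θ : ℝ} {a : ℕ → ℕ} (h : HasCF θ a) (k : ℕ) :
    alphaIter θ k ∈ Set.Ioo (0 : ℝ) 1 := by
  cases k with
  | zero => exact h.1
  | succ k =>
    refine ⟨lt_of_le_of_ne (Int.fract_nonneg _) ?_, Int.fract_lt_one _⟩
    exact (irrational_alphaIter h.2.1 (k + 1)).ne_zero.symm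

theorem HasCF.alphaIter_eq {θ : ℝ} {a : ℕ → ℕ} (h : HasCF θ a) (k : ℕ) :
    alphaIter θ k = 1 / (a k + alphaIter θ (k + 1)) := by
  have hfl : ((⌊1 / alphaIter θ k⌋ : ℤ) : ℝ) = a k := by rw [h.2.2 k]; simp
  have hs : alphaIter θ (k + 1) = 1 / alphaIter θ k - a k := by
    rw [← hfl]; rfl
  rw [hs]
  simp

/-- A continued fraction tail whose first digit is positive and whose next three digits are `1`
is less than `5 / 8`. -/
theorem HasCF.alphaIter_lt_five_eighths {θ : ℝ} {a : ℕ → ℕ} (h : HasCF θ a) {p : ℕ}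
    (h0 : 0 < a p) (h1 : a (p + 1) = 1) (h2 : a (p + 2) = 1) (h3 : a (p + 3) = 1) :
    alphaIter θ p < 5 / 8 := by
  have e0 := h.alphaIter_eq p
  have e1 := h.alphaIter_eq (p + 1)
  have e2 := h.alphaIter_eq (p + 2)
  have e3 := h.alphaIter_eq (p + 3)
  obtain ⟨m1, -⟩ := h.alphaIter_mem_Ioo (p + 1)
  obtain ⟨m2, -⟩ := h.alphaIter_mem_Ioo (p + 2)
  obtain ⟨m3, -⟩ := h.alphaIter_mem_Ioo (p + 3)
  obtain ⟨m4, m4'⟩ := h.alphaIter_mem_Ioo (p + 3 + 1)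
  have h0' : (1 : ℝ) ≤ a p := by exact_mod_cast h0
  rw [h1, Nat.cast_one] at e1
  rw [h2, Nat.cast_one] at e2
  rw [h3, Nat.cast_one] at e3
  have b3 : 1 / 2 < alphaIter θ (p + 3) := by
    rw [e3, lt_div_iff₀ (by linarith)]; linarith
  have b2 : alphaIter θ (p + 2) < 2 / 3 := by
    rw [e2, div_lt_iff₀ (by linarith)]; linarith
  have b1 : 3 / 5 < alphaIter θ (p + 1) := by
    rw [e1, lt_div_iff₀ (by linarith)]; linarith
  rw [e0, div_lt_iff₀ (by linarith)]
  linarith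

theorem abs_log_div_lt_half {c x y : ℝ} (hc : 1 ≤ c) (hx : x ∈ Set.Ioo (0 : ℝ) (5 / 8))
    (hy : y ∈ Set.Ioo (0 : ℝ) (5 / 8)) :
    |Real.log ((1 / (c + x)) / (1 / (c + y)))| < 1 / 2 := by
  obtain ⟨hx0, hx1⟩ := hx
  obtain ⟨hy0, hy1⟩ := hy
  have key : Real.log (13 / 8) < 1 / 2 := by
    have h : Real.log ((13 / 8) ^ 2) < 1 := by
      rw [Real.log_lt_iff_lt_exp (by norm_num)]
      exact lt_trans (by norm_num) Real.exp_one_gt_d9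
    rw [Real.log_pow] at h
    push_cast at h
    linarith
  have bound : ∀ u v : ℝ, 0 < u → u < 5 / 8 → 0 < v →
      Real.log (c + u) - Real.log (c + v) < 1 / 2 := by
    intro u v hu hu' hv
    rw [← Real.log_div (by linarith) (by linarith)]
    refine lt_trans (Real.log_lt_log (div_pos (by linarith) (by linarith)) ?_) key
    rw [div_lt_iff₀ (by linarith)]
    linarith
  have h_inv : 1 / (c + x) / (1 / (c + y)) = (c + y) / (c + x) := by
    rw [div_div_eq_mul_div, div_one, one_div_mul_eq_div]
  rw [h_inv, Real.log_div (by linarith) (by linarith), abs_lt]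
  have h1 := bound x y hx0 hx1 hy0
  have h2 := bound y x hy0 hy1 hx0
  constructor <;> linarith

theorem log_add_sub_log_add_le {c u v : ℝ} (hc : 1 ≤ c) (hu : 0 < u) (huv : u ≤ v)
    (hv : v < 1) :
    2 * (Real.log (c + v) - Real.log (c + u)) ≤ Real.log v - Real.log u := by
  have hv0 : 0 < v := hu.trans_le huv
  have h : Real.log (u * (c + v) ^ 2) ≤ Real.log (v * (c + u) ^ 2) := by
    apply Real.log_le_log (by positivity)
    have h1 : 0 ≤ c ^ 2 - u * v := by nlinarith
    nlinarith [mul_nonneg (sub_nonneg.2 huv) h1]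
  rw [Real.log_mul hu.ne' (by positivity), Real.log_mul hv0.ne' (by positivity),
    Real.log_pow, Real.log_pow] at h
  push_cast at h
  linarith

/-- Prepending a common digit at least halves the logarithmic distance. -/
theorem two_mul_abs_log_div_le {c x y : ℝ} (hc : 1 ≤ c) (hx : x ∈ Set.Ioo (0 : ℝ) 1)
    (hy : y ∈ Set.Ioo (0 : ℝ) 1) :
    2 * |Real.log ((1 / (c + x)) / (1 / (c + y)))| ≤ |Real.log (x / y)| := by
  obtain ⟨hx0, hx1⟩ := hx
  obtain ⟨hy0, hy1⟩ := hy
  have h_inv : 1 / (c + x) / (1 / (c + y)) = (c + y) / (c + x) := by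
    rw [div_div_eq_mul_div, div_one, one_div_mul_eq_div]
  rw [h_inv, Real.log_div (by linarith) (by linarith),
    Real.log_div hx0.ne' hy0.ne']
  rcases le_total x y with h | h
  · have h1 := log_add_sub_log_add_le hc hx0 h hy1
    have h2 := Real.log_le_log (by linarith : 0 < c + x) (by linarith : c + x ≤ c + y)
    rw [abs_of_nonneg (by linarith), abs_of_nonpos (by linarith [Real.log_le_log hx0 h])]
    linarith
  · have h1 := log_add_sub_log_add_le hc hy0 h hx1
    have h2 := Real.log_le_log (by linarith : 0 < c + y) (by linarith : c + y ≤ c + x)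
    rw [abs_of_nonpos (by linarith), abs_of_nonneg (by linarith [Real.log_le_log hy0 h])]
    linarith

/-- If the digits of two numbers agree before position `p`, and both tails at `p` are less than
`5 / 8`, then the logarithmic distance of the tails decays geometrically away from `p`. -/
theorem HasCF.abs_log_alphaIter_div_lt {θ η : ℝ} {a b : ℕ → ℕ} (hθ : HasCF θ a)
    (hη : HasCF η b) {p : ℕ} (hab : ∀ k < p, b k = a k) (ha : ∀ k < p, 0 < a k)
    (hθp : alphaIter θ p < 5 / 8) (hηp : alphaIter η p < 5 / 8) (d : ℕ) :
    ∀ k, k + d + 1 = p → |Real.log (alphaIter θ k / alphaIter η k)| < (1 / 2) ^ (d + 1) := by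
  induction d with
  | zero =>
    intro k hk
    have hk' : k + 1 = p := hk
    have hc : (1 : ℝ) ≤ a k := by exact_mod_cast ha k (by omega)
    rw [hθ.alphaIter_eq, hη.alphaIter_eq, hab k (by omega), hk']
    simpa using abs_log_div_lt_half hc ⟨(hθ.alphaIter_mem_Ioo p).1, hθp⟩
      ⟨(hη.alphaIter_mem_Ioo p).1, hηp⟩
  | succ d ih =>
    intro k hk
    have hc : (1 : ℝ) ≤ a k := by exact_mod_cast ha k (by omega)
    have h := ih (k + 1) (by omega)
    have h2 := two_mul_abs_log_div_le hc (hθ.alphaIter_mem_Ioo (k + 1))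
      (hη.alphaIter_mem_Ioo (k + 1))
    rw [hθ.alphaIter_eq k, hη.alphaIter_eq k, hab k (by omega), pow_succ]
    linarith

theorem betaDigits_pos {n m N : ℕ} {a : ℕ → ℕ} (ha : ∀ i < n, 0 < a i) (hN : 0 < N) (k : ℕ) :
    0 < betaDigits n m N a k := by
  unfold betaDigits
  split_ifs with h1 h2
  exacts [hN, ha k h2, one_pos]

theorem HasCF.alphaIter_betaDigits_lt {θ : ℝ} {n m N : ℕ} {a : ℕ → ℕ}
    (h : HasCF θ (betaDigits n m N a)) (hm : 0 < m) (ha : ∀ i < n, 0 < a i) (hN : 0 < N) :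
    alphaIter θ (n + m - 1) < 5 / 8 := by
  have h1 : ∀ k, n + m ≤ k → betaDigits n m N a k = 1 := fun k hk => by
    unfold betaDigits
    rw [if_neg (by omega), if_neg (by omega)]
  exact h.alphaIter_lt_five_eighths (betaDigits_pos ha hN _) (h1 _ (by omega))
    (h1 _ (by omega)) (h1 _ (by omega))

/-- Lemma `4lems` part 2: for `1 ≤ i < n+m`,
`|log(α_i(β^N)/α_i(β^1))| < 2^{i-(n+m)}`. -/
theorem alpha_log_ratio_one
    (n m : ℕ) (hm : 0 < m) (a : ℕ → ℕ) (ha : ∀ i < n, 0 < a i)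
    (N : ℕ) (hN : 0 < N)
    (βN β1 : ℝ)
    (hβN : HasCF βN (betaDigits n m N a))
    (hβ1 : HasCF β1 (betaDigits n m 1 a))
    (i : ℕ) (hi1 : 1 ≤ i) (hi2 : i < n + m) :
    |Real.log (alphaIter βN (i - 1) / alphaIter β1 (i - 1))|
      < (2 : ℝ) ^ ((i : ℤ) - (n + m)) := by
  have key := hβN.abs_log_alphaIter_div_lt hβ1 (p := n + m - 1)
    (fun k hk => by
      unfold betaDigits
      rw [if_neg (by omega), if_neg (show ¬ k + 1 = n + m by omega)])
    (fun k _ => betaDigits_pos ha hN k) (hβN.alphaIter_betaDigits_lt hm ha hN)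
    (hβ1.alphaIter_betaDigits_lt hm ha one_pos) (n + m - i - 1) (i - 1) (by omega)
  convert key using 1
  have he : (i : ℤ) - (n + m) = -((n + m - i - 1 + 1 : ℕ) : ℤ) := by omega
  rw [he, zpow_neg, zpow_natCast, one_div, inv_pow]
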